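/- Fix an S-structure (𝕊, ℙ). Two pseudovertices v and v' have a common upper bound in the partial order ≤ if and only if im(v) = im(v'). Consequently, for every Y ⊆ X that is a nonempty finite disjoint union of domains, the set 𝒫𝒱_{𝕊,Y} of pseudovertices with image Y is a directed set under ≤ (and the rank function v ↦ |v| is strictly increasing along expansions, making it a ranked directed set). -/

import Mathlib

set_option autoImplicit false

namespace GTLD

/-- A partial bijection of `X`: a functional, injective relation on `X`.
It represents a bijection between its domain and its image. -/
structure PartialBij (X : Type*) where
  rel : X → X → Prop
  functional : ∀ ⦃x y y'⦄, rel x y → rel x y' → y = y'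
  injective : ∀ ⦃x x' y⦄, rel x y → rel x' y → x = x'

namespace PartialBij

variable {X : Type*}

/-- The domain of a partial bijection. -/
def domSet (f : PartialBij X) : Set X :=
  {x | ∃ y, f.rel x y}

/-- The image of a partial bijection. -/
def imgSet (f : PartialBij X) : Set X :=
  {y | ∃ x, f.rel x y}

/-- The image of a set under a partial bijection. -/
def image (f : PartialBij X) (A : Set X) : Set X :=
  {y | ∃ x ∈ A, f.rel x y}

/-- Composition `g ∘ f` of partial bijections (first apply `f`, then `g`);
this is the composition `g ∘ f : f⁻¹(B ∩ C) → g(B ∩ C)` of the paper. -/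
def comp (g f : PartialBij X) : PartialBij X where
  rel := fun x z => ∃ y, f.rel x y ∧ g.rel y z
  functional := by
    rintro x z z' ⟨y, h1, h2⟩ ⟨y', h1', h2'⟩
    cases f.functional h1 h1'
    exact g.functional h2 h2'
  injective := by
    rintro x x' z ⟨y, h1, h2⟩ ⟨y', h1', h2'⟩
    cases g.injective h2 h2'
    exact f.injective h1 h1'

/-- The inverse of a partial bijection. -/
def inv (f : PartialBij X) : PartialBij X where
  rel := fun x y => f.rel y x
  functional := by
    intro x y y' h h'
    exact f.injective h h'
  injective := by
    intro x x' y h h'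
    exact f.functional h h'

/-- The restriction of a partial bijection to a subset. -/
def restrict (f : PartialBij X) (A : Set X) : PartialBij X where
  rel := fun x y => x ∈ A ∧ f.rel x y
  functional := by
    rintro x y y' ⟨_, h⟩ ⟨_, h'⟩
    exact f.functional h h'
  injective := by
    rintro x x' y ⟨_, h⟩ ⟨_, h'⟩
    exact f.injective h h'

/-- The identity partial bijection on a subset `A ⊆ X`. -/
def idOn (A : Set X) : PartialBij X where
  rel := fun x y => x ∈ A ∧ x = y
  functional := by
    rintro x y y' ⟨_, h1⟩ ⟨_, h2⟩
    rw [← h1, ← h2]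
  injective := by
    rintro x x' y ⟨_, h1⟩ ⟨_, h2⟩
    rw [h1, h2]

end PartialBij

variable {X : Type*}

/-- `D` is a domain for `S`: it is the domain of some element of `S`. -/
def IsDomain (S : Set (PartialBij X)) (D : Set X) : Prop :=
  ∃ s ∈ S, s.domSet = D

/-- `Y` is a finite disjoint union of domains. -/
def FinDisjUnionOfDomains (S : Set (PartialBij X)) (Y : Set X) : Prop :=
  ∃ (n : ℕ) (D : Fin n → Set X), (∀ i, IsDomain S (D i)) ∧
    (∀ i j, i ≠ j → D i ∩ D j = ∅) ∧ (⋃ i, D i) = Y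

/-- A partial bijection is locally determined by `S`: its domain and image admit
finite partitions into domains such that the restriction of the bijection to each
member of the first partition is an element of `S` mapping it bijectively onto the
corresponding member of the second. -/
def LocallyDetermined (S : Set (PartialBij X)) (f : PartialBij X) : Prop :=
  ∃ (m : ℕ) (t : Fin m → PartialBij X),
    (∀ i, t i ∈ S) ∧
    (∀ i j, i ≠ j → (t i).domSet ∩ (t j).domSet = ∅) ∧
    (∀ i j, i ≠ j → (t i).imgSet ∩ (t j).imgSet = ∅) ∧
    (⋃ i, (t i).domSet) = f.domSet ∧
    (∀ x y, f.rel x y ↔ ∃ i, (t i).rel x y)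

/-- Membership in the group `Γ_S`: a bijection of all of `X` that is
locally determined by `S`. -/
def MemGamma (S : Set (PartialBij X)) (γ : PartialBij X) : Prop :=
  γ.domSet = Set.univ ∧ γ.imgSet = Set.univ ∧ LocallyDetermined S γ

/-- `Pt` is a partition of `D` (into nonempty pieces). -/
def IsPartitionOf (Pt : Set (Set X)) (D : Set X) : Prop :=
  ∅ ∉ Pt ∧ ⋃₀ Pt = D ∧ ∀ P ∈ Pt, ∀ Q ∈ Pt, P ≠ Q → P ∩ Q = ∅

/-- The set of domains of `S` has the compact ultrametric property:
intersecting domains are nested, and the complement of a domain is a finite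
union of domains. -/
def CompactUltrametric (S : Set (PartialBij X)) : Prop :=
  (∀ D₁ D₂, IsDomain S D₁ → IsDomain S D₂ → (D₁ ∩ D₂).Nonempty →
    D₁ ⊆ D₂ ∨ D₂ ⊆ D₁) ∧
  (∀ D, IsDomain S D → ∃ (n : ℕ) (E : Fin n → Set X),
    (∀ i, IsDomain S (E i)) ∧ (⋃ i, E i) = Dᶜ)

/-- `F` is the greatest proper nonempty subdomain of `D` containing `x`. -/
def IsGreatestProperSub (S : Set (PartialBij X)) (D F : Set X) (x : X) : Prop :=
  IsDomain S F ∧ x ∈ F ∧ F ⊂ D ∧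
    ∀ F', IsDomain S F' → x ∈ F' → F' ⊂ D → F' ⊆ F

/-- `maxPart` assigns to each nonempty domain its maximal partition: the partition
into greatest proper nonempty subdomains, or `{D}` if `D` has no proper nonempty
subdomain. -/
def MaxPartSpec (S : Set (PartialBij X)) (maxPart : Set X → Set (Set X)) : Prop :=
  ∀ D, IsDomain S D → D.Nonempty →
    ((∃ F, IsDomain S F ∧ F.Nonempty ∧ F ⊂ D) →
      maxPart D = {F | ∃ x ∈ D, IsGreatestProperSub S D F x}) ∧
    ((¬ ∃ F, IsDomain S F ∧ F.Nonempty ∧ F ⊂ D) → maxPart D = {D})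

/-- An `S`-structure: a structure function `str` assigning structure sets to pairs
of nonempty domains, and a pattern function `pat` assigning sets of patterns
(finite partitions into domains) to nonempty domains, subject to the axioms
(P1)-(P5) and (S1)-(S6). -/
structure SStructure (S : Set (PartialBij X)) where
  str : Set X → Set X → Set (PartialBij X)
  pat : Set X → Set (Set (Set X))
  /-- (P1) the trivial partition is a pattern -/
  pat_trivial : ∀ D, IsDomain S D → D.Nonempty → {D} ∈ pat D
  /-- (P2) each pattern is a finite partition of `D` into domains -/
  pat_partition : ∀ D, IsDomain S D → D.Nonempty → ∀ Pt ∈ pat D,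
    Pt.Finite ∧ IsPartitionOf Pt D ∧ ∀ P ∈ Pt, IsDomain S P
  /-- (P3) restriction -/
  pat_restrict : ∀ D E, IsDomain S D → D.Nonempty → IsDomain S E → E.Nonempty →
    E ⊆ D → ∀ Pt ∈ pat D, {Q | ∃ P ∈ Pt, (P ∩ E).Nonempty ∧ Q = P ∩ E} ∈ pat E
  /-- (P4) patchwork -/
  pat_patchwork : ∀ D, IsDomain S D → D.Nonempty → ∀ Pt ∈ pat D,
    ∀ F : Set X → Set (Set X), (∀ P ∈ Pt, F P ∈ pat P) →
    {Q | ∃ P ∈ Pt, Q ∈ F P} ∈ pat D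
  /-- (P5) cofinality -/
  pat_cofinal : ∀ D, IsDomain S D → D.Nonempty →
    ∀ Pt' : Set (Set X), Pt'.Finite → IsPartitionOf Pt' D →
    (∀ P ∈ Pt', IsDomain S P) →
    ∃ Pt ∈ pat D, ∀ P ∈ Pt, ∃ P' ∈ Pt', P ⊆ P'
  /-- (S1) elements of `str D₁ D₂` lie in `S`, with domain `D₁` and image `D₂` -/
  str_mem : ∀ D₁ D₂, ∀ s ∈ str D₁ D₂, s ∈ S ∧ s.domSet = D₁ ∧ s.imgSet = D₂
  /-- (S2) identities -/
  str_id : ∀ D, IsDomain S D → D.Nonempty → PartialBij.idOn D ∈ str D D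
  /-- (S3) inverses -/
  str_inv : ∀ D₁ D₂, ∀ s ∈ str D₁ D₂, PartialBij.inv s ∈ str D₂ D₁
  /-- (S4) compositions -/
  str_comp : ∀ D₁ D₂ D₃, ∀ s₁ ∈ str D₁ D₂, ∀ s₂ ∈ str D₂ D₃,
    PartialBij.comp s₂ s₁ ∈ str D₁ D₃
  /-- (S5) generation -/
  generation : ∀ f : PartialBij X, IsDomain S f.domSet → f.domSet.Nonempty →
    LocallyDetermined S f →
    ∃ Pt ∈ pat f.domSet, ∀ E ∈ Pt,
      f.restrict E ∈ S ∧ f.restrict E ∈ str E (f.image E)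
  /-- (S6) `𝕊`-invariance of `ℙ` -/
  pat_invariant : ∀ D₁ D₂, IsDomain S D₁ → D₁.Nonempty → ∀ Pt ∈ pat D₁,
    ∀ s ∈ str D₁ D₂, {Q | ∃ P ∈ Pt, Q = PartialBij.image s P} ∈ pat D₂

/-- The maximal `S`-structure: the structure sets are all elements of `S` with the
given domain and image, and the patterns are all finite partitions into domains. -/
def IsMaximalSStructure {S : Set (PartialBij X)} (SS : SStructure S) : Prop :=
  (∀ D₁ D₂, IsDomain S D₁ → D₁.Nonempty → IsDomain S D₂ → D₂.Nonempty →
    SS.str D₁ D₂ = {s | s ∈ S ∧ s.domSet = D₁ ∧ s.imgSet = D₂}) ∧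
  (∀ D, IsDomain S D → D.Nonempty →
    SS.pat D = {Pt | Pt.Finite ∧ IsPartitionOf Pt D ∧ ∀ P ∈ Pt, IsDomain S P})

/-- `f` is (a representative of) an element `[f, D]` of `ℬ`: its domain is a
nonempty domain and it is locally determined by `S`. -/
def IsSPair (S : Set (PartialBij X)) (f : PartialBij X) : Prop :=
  IsDomain S f.domSet ∧ f.domSet.Nonempty ∧ LocallyDetermined S f

/-- The fundamental equivalence relation on pairs: `(f, D₁) ∼ (g, D₂)` iff
`f = g ∘ h` for some `h ∈ 𝕊(D₁, D₂)`. -/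
def PairRel {S : Set (PartialBij X)} (SS : SStructure S) (f g : PartialBij X) : Prop :=
  ∃ h ∈ SS.str f.domSet g.domSet, f = PartialBij.comp g h

/-- A pseudovertex: a nonempty finite set of (representatives of) elements of `ℬ`
whose images are pairwise disjoint. -/
def IsPseudovertex (S : Set (PartialBij X)) (v : Set (PartialBij X)) : Prop :=
  v.Finite ∧ v.Nonempty ∧ (∀ f ∈ v, IsSPair S f) ∧
    ∀ f ∈ v, ∀ g ∈ v, f ≠ g → f.imgSet ∩ g.imgSet = ∅

/-- The image of a pseudovertex. -/
def PVImage (v : Set (PartialBij X)) : Set X :=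
  ⋃ f ∈ v, f.imgSet

/-- Two (representative sets of) pseudovertices are equal as sets of equivalence
classes. -/
def PVEquiv {S : Set (PartialBij X)} (SS : SStructure S)
    (v w : Set (PartialBij X)) : Prop :=
  (∀ f ∈ v, ∃ g ∈ w, PairRel SS f g) ∧ (∀ g ∈ w, ∃ f ∈ v, PairRel SS f g)

/-- An expansion of a pseudovertex `v` at an element `f ∈ v`: replace `f` by the
pieces `(f ∘ h)|_E` for `E` in a nontrivial pattern `Pt` of a domain `D̂`, where
`h ∈ 𝕊(D̂, dom f)`. -/
def Expansion {S : Set (PartialBij X)} (SS : SStructure S)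
    (v v' : Set (PartialBij X)) : Prop :=
  ∃ f ∈ v, ∃ (Dh : Set X) (h : PartialBij X) (Pt : Set (Set X)),
    h ∈ SS.str Dh f.domSet ∧ Pt ∈ SS.pat Dh ∧
    (∃ P ∈ Pt, ∃ Q ∈ Pt, P ≠ Q) ∧
    v' = (v \ {f}) ∪ {g | ∃ E ∈ Pt, g = (PartialBij.comp f h).restrict E}

/-- The partial order on pseudovertices induced by expansion (at the level of
sets of equivalence classes): `v ≤ w` iff a finite (possibly empty) sequence of
expansions leads from `v` to a pseudovertex equal to `w` as a set of classes. -/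
def PVLE {S : Set (PartialBij X)} (SS : SStructure S)
    (v w : Set (PartialBij X)) : Prop :=
  ∃ w', Relation.ReflTransGen (Expansion SS) v w' ∧ PVEquiv SS w' w

/-- Strict version of `PVLE`. -/
def PVLT {S : Set (PartialBij X)} (SS : SStructure S)
    (v w : Set (PartialBij X)) : Prop :=
  PVLE SS v w ∧ ¬ PVEquiv SS v w

/-- The action of a partial bijection `s` on a pseudovertex:
`s · {[f₁,D₁],…,[fₘ,Dₘ]} = {[s∘f₁,D₁],…,[s∘fₘ,Dₘ]}`. -/
def PVAct (s : PartialBij X) (v : Set (PartialBij X)) : Set (PartialBij X) :=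
  (fun f => PartialBij.comp s f) '' v

/-- Two pseudovertices have the same type: there is a bijection between them
matching domains of the same domain type. -/
def SameType {S : Set (PartialBij X)} (SS : SStructure S)
    (v w : Set (PartialBij X)) : Prop :=
  ∃ φ : PartialBij X → PartialBij X, Set.BijOn φ v w ∧
    ∀ f ∈ v, (SS.str f.domSet (φ f).domSet).Nonempty

/-- The stabilizer of a pseudovertex `v` in `Γ_S`. -/
def PVStab {S : Set (PartialBij X)} (SS : SStructure S)
    (v : Set (PartialBij X)) : Set (PartialBij X) :=
  {γ | MemGamma S γ ∧ PVEquiv SS (PVAct γ v) v}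

/-- The subgroup of the stabilizer fixing each class `[f, D] ∈ v`. -/
def PVStabFix {S : Set (PartialBij X)} (SS : SStructure S)
    (v : Set (PartialBij X)) : Set (PartialBij X) :=
  {γ | MemGamma S γ ∧ ∀ f ∈ v, PairRel SS (PartialBij.comp γ f) f}

/-- `Pt₁ ⪯ Pt₂`: the partition `Pt₂` is obtained from `Pt₁` by replacing each
member `D` of `Pt₁` by a pattern of `D`. -/
def PatRefines {S : Set (PartialBij X)} (SS : SStructure S)
    (Pt₁ Pt₂ : Set (Set X)) : Prop :=
  ∃ F : Set X → Set (Set X), (∀ D ∈ Pt₁, F D ∈ SS.pat D) ∧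
    Pt₂ = {Q | ∃ D ∈ Pt₁, Q ∈ F D}

/-- A simple expansion: an expansion using the maximal partition. -/
def SimpleExpansion {S : Set (PartialBij X)} (SS : SStructure S)
    (maxPart : Set X → Set (Set X)) (v v' : Set (PartialBij X)) : Prop :=
  ∃ f ∈ v, ∃ (Dh : Set X) (h : PartialBij X),
    h ∈ SS.str Dh f.domSet ∧
    (∃ P ∈ maxPart Dh, ∃ Q ∈ maxPart Dh, P ≠ Q) ∧
    v' = (v \ {f}) ∪ {g | ∃ E ∈ maxPart Dh, g = (PartialBij.comp f h).restrict E}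

/-- `v'` is the result of `ℰ`-expansion from `v`. -/
def EExpansionFrom (E : PartialBij X → Set (Set (PartialBij X)))
    (v v' : Set (PartialBij X)) : Prop :=
  ∃ F : PartialBij X → Set (PartialBij X),
    (∀ f ∈ v, F f ∈ E f) ∧ v' = ⋃ f ∈ v, F f

/-- `E` is an expansion scheme: conditions (1)-(4) of Definition 6.1. -/
def IsExpansionScheme {S : Set (PartialBij X)} (SS : SStructure S)
    (E : PartialBij X → Set (Set (PartialBij X))) : Prop :=
  ∀ f : PartialBij X, IsSPair S f →
    (∀ w ∈ E f, IsPseudovertex S w ∧ PVLE SS {f} w) ∧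
    ({f} ∈ E f) ∧
    (∀ s : PartialBij X, LocallyDetermined S s → f.imgSet ⊆ s.domSet →
      (∀ w ∈ E f, ∃ w' ∈ E (PartialBij.comp s f), PVEquiv SS (PVAct s w) w') ∧
      (∀ w' ∈ E (PartialBij.comp s f), ∃ w ∈ E f, PVEquiv SS (PVAct s w) w')) ∧
    (∀ w₁ ∈ E f, ∀ w₂ ∈ E f, PVLE SS w₁ w₂ → EExpansionFrom E w₁ w₂)

/-- An `ℰ`-chain: a strictly increasing sequence of pseudovertices, each of which
is the result of `ℰ`-expansion from the first. -/
def IsEChain {S : Set (PartialBij X)} (SS : SStructure S)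
    (E : PartialBij X → Set (Set (PartialBij X)))
    (m : ℕ) (c : Fin (m + 1) → Set (PartialBij X)) : Prop :=
  (∀ i, IsPseudovertex S (c i)) ∧
  (∀ i j : Fin (m + 1), i < j → PVLT SS (c i) (c j)) ∧
  (∀ i, EExpansionFrom E (c 0) (c i))

end GTLD

namespace GTLD

theorem PartialBij.ext_rel {X : Type*} {f g : PartialBij X}
    (h : ∀ x y, f.rel x y ↔ g.rel x y) : f = g := by
  cases f; cases g
  congr
  funext x y
  exact propext (h x y)

theorem domSet_idOn {X : Type*} (A : Set X) : (PartialBij.idOn A).domSet = A := by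
  ext x; simp [PartialBij.domSet, PartialBij.idOn]

theorem imgSet_idOn {X : Type*} (A : Set X) : (PartialBij.idOn A).imgSet = A := by
  ext x; simp [PartialBij.imgSet, PartialBij.idOn]

section aux

variable {X : Type*} {S : Set (PartialBij X)}

theorem idOn_mem (hcomp : ∀ f ∈ S, ∀ g ∈ S, PartialBij.comp g f ∈ S)
    (hinv : ∀ f ∈ S, PartialBij.inv f ∈ S) {E : Set X} (hE : IsDomain S E) :
    PartialBij.idOn E ∈ S := by
  obtain ⟨s, hs, rfl⟩ := hE
  have := hcomp s hs _ (hinv s hs)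
  convert this using 1
  apply PartialBij.ext_rel
  intro x y
  constructor
  · rintro ⟨⟨z, hz⟩, rfl⟩
    exact ⟨z, hz, hz⟩
  · rintro ⟨z, h1, h2⟩
    exact ⟨⟨z, h1⟩, s.injective h1 h2⟩

theorem spair_idOn (hcomp : ∀ f ∈ S, ∀ g ∈ S, PartialBij.comp g f ∈ S)
    (hinv : ∀ f ∈ S, PartialBij.inv f ∈ S) {E : Set X} (hE : IsDomain S E)
    (hne : E.Nonempty) : IsSPair S (PartialBij.idOn E) := by
  refine ⟨by rwa [domSet_idOn], by rwa [domSet_idOn], 1, fun _ => PartialBij.idOn E,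
    fun _ => idOn_mem hcomp hinv hE, ?_, ?_, ?_, ?_⟩
  · intro i j hij; exact absurd (Subsingleton.elim i j) hij
  · intro i j hij; exact absurd (Subsingleton.elim i j) hij
  · exact Set.iUnion_const _
  · simp

theorem domain_inter (hcomp : ∀ f ∈ S, ∀ g ∈ S, PartialBij.comp g f ∈ S)
    (hinv : ∀ f ∈ S, PartialBij.inv f ∈ S) {E F : Set X} (hE : IsDomain S E)
    (hF : IsDomain S F) : IsDomain S (E ∩ F) := by
  refine ⟨_, hcomp _ (idOn_mem hcomp hinv hE) _ (idOn_mem hcomp hinv hF), ?_⟩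
  ext x
  constructor
  · rintro ⟨y, z, ⟨h1, rfl⟩, h2, rfl⟩; exact ⟨h1, h2⟩
  · rintro ⟨h1, h2⟩; exact ⟨x, x, ⟨h1, rfl⟩, h2, rfl⟩

theorem restrict_locdet (hcomp : ∀ f ∈ S, ∀ g ∈ S, PartialBij.comp g f ∈ S)
    (hinv : ∀ f ∈ S, PartialBij.inv f ∈ S) {f h : PartialBij X} {E : Set X}
    (hf : LocallyDetermined S f) (hh : h ∈ S) (hE : IsDomain S E) :
    LocallyDetermined S ((PartialBij.comp f h).restrict E) := by
  obtain ⟨m, t, h1, h2, h3, h4, h5⟩ := hf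
  have key : ∀ x y, ((PartialBij.comp f h).restrict E).rel x y ↔
      ∃ i, (PartialBij.comp (t i) (PartialBij.comp h (PartialBij.idOn E))).rel x y := by
    intro x y
    constructor
    · rintro ⟨hx, z, hz, hzy⟩
      obtain ⟨i, hi⟩ := (h5 _ _).1 hzy
      exact ⟨i, z, ⟨x, ⟨hx, rfl⟩, hz⟩, hi⟩
    · rintro ⟨i, z, ⟨x', ⟨hx, rfl⟩, hz⟩, hi⟩
      exact ⟨hx, z, hz, (h5 _ _).2 ⟨i, hi⟩⟩
  refine ⟨m, fun i => PartialBij.comp (t i) (PartialBij.comp h (PartialBij.idOn E)),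
    fun i => hcomp _ (hcomp _ (idOn_mem hcomp hinv hE) _ hh) _ (h1 i), ?_, ?_, ?_, key⟩
  · intro i j hij
    rw [Set.eq_empty_iff_forall_notMem]
    rintro x ⟨⟨y, z, ⟨_, ⟨_, rfl⟩, hz⟩, hi⟩, ⟨y', z', ⟨_, ⟨_, rfl⟩, hz'⟩, hi'⟩⟩
    have hzz := h.functional hz hz'
    subst hzz
    have : z ∈ (t i).domSet ∩ (t j).domSet := ⟨⟨y, hi⟩, ⟨y', hi'⟩⟩
    rw [h2 i j hij] at this
    exact this
  · intro i j hij
    rw [Set.eq_empty_iff_forall_notMem]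
    rintro y ⟨⟨x, z, _, hi⟩, ⟨x', z', _, hi'⟩⟩
    have : y ∈ (t i).imgSet ∩ (t j).imgSet := ⟨⟨z, hi⟩, ⟨z', hi'⟩⟩
    rw [h3 i j hij] at this
    exact this
  · ext x
    simp only [Set.mem_iUnion]
    constructor
    · rintro ⟨i, y, hy⟩; exact ⟨y, (key x y).2 ⟨i, hy⟩⟩
    · rintro ⟨y, hy⟩
      obtain ⟨i, hi⟩ := (key x y).1 hy
      exact ⟨i, y, hi⟩

/-- The set of pieces produced by an expansion at `f`. -/
def Pieces (f h : PartialBij X) (Pt : Set (Set X)) : Set (PartialBij X) :=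
  {g | ∃ E ∈ Pt, g = (PartialBij.comp f h).restrict E}

structure PiecesFacts (S : Set (PartialBij X)) (f : PartialBij X)
    (N : Set (PartialBij X)) : Prop where
  fin : N.Finite
  ne : N.Nonempty
  spair : ∀ g ∈ N, IsSPair S g
  disj : ∀ g ∈ N, ∀ g' ∈ N, g ≠ g' → g.imgSet ∩ g'.imgSet = ∅
  img : PVImage N = f.imgSet

theorem img_ne {f : PartialBij X} (hf : IsSPair S f) : f.imgSet.Nonempty := by
  obtain ⟨x, y, hxy⟩ := hf.2.1
  exact ⟨y, x, hxy⟩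

theorem str_dom (SS : SStructure S) {f h : PartialBij X} {Dh : Set X}
    (hf : IsSPair S f) (hh : h ∈ SS.str Dh f.domSet) : IsDomain S Dh ∧ Dh.Nonempty := by
  obtain ⟨h1, h2, h3⟩ := SS.str_mem _ _ _ hh
  refine ⟨⟨h, h1, h2⟩, ?_⟩
  obtain ⟨x, hx⟩ := hf.2.1
  rw [← h3] at hx
  obtain ⟨z, hz⟩ := hx
  rw [← h2]
  exact ⟨z, x, hz⟩

theorem dom_piece (SS : SStructure S) {f h : PartialBij X} {Dh : Set X} {E : Set X}
    (hh : h ∈ SS.str Dh f.domSet) (hE : E ⊆ Dh) :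
    ((PartialBij.comp f h).restrict E).domSet = E := by
  obtain ⟨h1, h2, h3⟩ := SS.str_mem _ _ _ hh
  ext x
  constructor
  · rintro ⟨y, hx, _⟩; exact hx
  · intro hx
    have : x ∈ h.domSet := h2 ▸ hE hx
    obtain ⟨z, hz⟩ := this
    have : z ∈ f.domSet := h3 ▸ ⟨x, hz⟩
    obtain ⟨y, hy⟩ := this
    exact ⟨y, hx, z, hz, hy⟩

theorem pieces_facts (hcomp : ∀ f ∈ S, ∀ g ∈ S, PartialBij.comp g f ∈ S)
    (hinv : ∀ f ∈ S, PartialBij.inv f ∈ S) (SS : SStructure S)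
    {f h : PartialBij X} {Dh : Set X} {Pt : Set (Set X)} (hf : IsSPair S f)
    (hh : h ∈ SS.str Dh f.domSet) (hP : Pt ∈ SS.pat Dh) :
    PiecesFacts S f (Pieces f h Pt) := by
  obtain ⟨hD, hDne⟩ := str_dom SS hf hh
  obtain ⟨hfin, ⟨he, hU, hdisj⟩, hdom⟩ := SS.pat_partition _ hD hDne _ hP
  obtain ⟨hS, hdm, him⟩ := SS.str_mem _ _ _ hh
  have hsub : ∀ E ∈ Pt, E ⊆ Dh := fun E hE => hU ▸ Set.subset_sUnion_of_mem hE
  refine ⟨?_, ?_, ?_, ?_, ?_⟩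
  · refine (hfin.image (fun E => (PartialBij.comp f h).restrict E)).subset ?_
    rintro g ⟨E, hE, rfl⟩
    exact ⟨E, hE, rfl⟩
  · obtain ⟨x, hx⟩ := hDne
    rw [← hU] at hx
    obtain ⟨E, hE, _⟩ := hx
    exact ⟨_, E, hE, rfl⟩
  · rintro g ⟨E, hE, rfl⟩
    have hd := dom_piece SS hh (hsub E hE)
    refine ⟨?_, ?_, restrict_locdet hcomp hinv hf.2.2 hS (hdom E hE)⟩
    · rw [hd]; exact hdom E hE
    · rw [hd]
      by_contra hne
      rw [Set.not_nonempty_iff_eq_empty] at hne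
      exact he (hne ▸ hE)
  · rintro g ⟨E, hE, rfl⟩ g' ⟨E', hE', rfl⟩ hne
    rw [Set.eq_empty_iff_forall_notMem]
    rintro y ⟨⟨x, hx, hxy⟩, ⟨x', hx', hxy'⟩⟩
    have := (PartialBij.comp f h).injective hxy hxy'
    subst this
    have hEE : E ≠ E' := by rintro rfl; exact hne rfl
    have h0 := hdisj E hE E' hE' hEE
    have : x ∈ E ∩ E' := ⟨hx, hx'⟩
    rw [h0] at this
    exact this
  · ext y
    simp only [PVImage, Set.mem_iUnion]
    constructor
    · rintro ⟨g, ⟨E, hE, rfl⟩, x, _, z, _, hz⟩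
      exact ⟨z, hz⟩
    · rintro ⟨z, hz⟩
      have : z ∈ h.imgSet := him ▸ ⟨y, hz⟩
      obtain ⟨x, hx⟩ := this
      have hxD : x ∈ ⋃₀ Pt := hU ▸ hdm ▸ ⟨z, hx⟩
      obtain ⟨E, hE, hxE⟩ := hxD
      exact ⟨_, ⟨E, hE, rfl⟩, x, hxE, z, hx, hz⟩

theorem sub_img {v : Set (PartialBij X)} {g : PartialBij X} (hg : g ∈ v) :
    g.imgSet ⊆ PVImage v := by
  intro y hy
  simp only [PVImage, Set.mem_iUnion]
  exact ⟨g, hg, hy⟩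

theorem disj_notMem {A B : Set X} (h : A ∩ B = ∅) {x : X} (h1 : x ∈ A) (h2 : x ∈ B) : False := by
  have : x ∈ A ∩ B := ⟨h1, h2⟩
  rw [h] at this
  exact this

theorem replace_pv {v : Set (PartialBij X)} {f : PartialBij X} {N : Set (PartialBij X)}
    (hv : IsPseudovertex S v) (hf : f ∈ v) (hN : PiecesFacts S f N) :
    IsPseudovertex S ((v \ {f}) ∪ N) ∧ PVImage ((v \ {f}) ∪ N) = PVImage v := by
  obtain ⟨h1, h2, h3, h4⟩ := hv
  have cross : ∀ g ∈ v \ {f}, ∀ g' ∈ N, g.imgSet ∩ g'.imgSet = ∅ := by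
    intro g hg g' hg'
    rw [Set.eq_empty_iff_forall_notMem]
    rintro y ⟨hy, hy'⟩
    exact disj_notMem (h4 g hg.1 f hf hg.2) hy (hN.img ▸ sub_img hg' hy')
  refine ⟨⟨(h1.subset Set.diff_subset).union hN.fin, hN.ne.inr, ?_, ?_⟩, ?_⟩
  · rintro g (hg | hg)
    · exact h3 g hg.1
    · exact hN.spair g hg
  · rintro g (hg | hg) g' (hg' | hg') hne
    · exact h4 g hg.1 g' hg'.1 hne
    · exact cross g hg g' hg'
    · rw [Set.inter_comm]; exact cross g' hg' g hg
    · exact hN.disj g hg g' hg' hne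
  · have : PVImage ((v \ {f}) ∪ N) = PVImage (v \ {f}) ∪ PVImage N := by
      simp only [PVImage, Set.biUnion_union]
    rw [this, hN.img]
    ext y
    constructor
    · rintro (hy | hy)
      · simp only [PVImage, Set.mem_iUnion] at hy
        obtain ⟨g, hg, hy⟩ := hy
        exact sub_img hg.1 hy
      · exact sub_img hf hy
    · intro hy
      simp only [PVImage, Set.mem_iUnion] at hy
      obtain ⟨g, hg, hy⟩ := hy
      by_cases hgf : g = f
      · subst hgf; exact Or.inr hy
      · exact Or.inl (sub_img (v := v \ {f}) ⟨hg, hgf⟩ hy)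

theorem expansion_pv (hcomp : ∀ f ∈ S, ∀ g ∈ S, PartialBij.comp g f ∈ S)
    (hinv : ∀ f ∈ S, PartialBij.inv f ∈ S) (SS : SStructure S)
    {v v' : Set (PartialBij X)} (hv : IsPseudovertex S v) (h : Expansion SS v v') :
    IsPseudovertex S v' ∧ PVImage v' = PVImage v := by
  obtain ⟨f, hf, Dh, h, Pt, hh, hP, _, rfl⟩ := h
  exact replace_pv hv hf (pieces_facts hcomp hinv SS (hv.2.2.1 f hf) hh hP)

theorem chain_pv (hcomp : ∀ f ∈ S, ∀ g ∈ S, PartialBij.comp g f ∈ S)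
    (hinv : ∀ f ∈ S, PartialBij.inv f ∈ S) (SS : SStructure S)
    {v v' : Set (PartialBij X)} (hv : IsPseudovertex S v)
    (h : Relation.ReflTransGen (Expansion SS) v v') :
    IsPseudovertex S v' ∧ PVImage v' = PVImage v := by
  induction h with
  | refl => exact ⟨hv, rfl⟩
  | tail _ h2 ih =>
    have := expansion_pv hcomp hinv SS ih.1 h2
    exact ⟨this.1, this.2.trans ih.2⟩

theorem pairRel_img (SS : SStructure S) {f g : PartialBij X} (h : PairRel SS f g) :
    f.imgSet = g.imgSet := by
  obtain ⟨s, hs, hfg⟩ := h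
  obtain ⟨_, h2, h3⟩ := SS.str_mem _ _ _ hs
  rw [hfg]
  ext y
  constructor
  · rintro ⟨x, z, _, hz⟩; exact ⟨z, hz⟩
  · rintro ⟨z, hz⟩
    have : z ∈ s.imgSet := h3 ▸ ⟨y, hz⟩
    obtain ⟨x, hx⟩ := this
    exact ⟨x, z, hx, hz⟩

theorem pvEquiv_img (SS : SStructure S) {v w : Set (PartialBij X)} (h : PVEquiv SS v w) :
    PVImage v = PVImage w := by
  ext y
  simp only [PVImage, Set.mem_iUnion]
  constructor
  · rintro ⟨f, hf, hy⟩
    obtain ⟨g, hg, hr⟩ := h.1 f hf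
    exact ⟨g, hg, pairRel_img SS hr ▸ hy⟩
  · rintro ⟨g, hg, hy⟩
    obtain ⟨f, hf, hr⟩ := h.2 g hg
    exact ⟨f, hf, pairRel_img SS hr ▸ hy⟩

theorem pvle_img (hcomp : ∀ f ∈ S, ∀ g ∈ S, PartialBij.comp g f ∈ S)
    (hinv : ∀ f ∈ S, PartialBij.inv f ∈ S) (SS : SStructure S)
    {v w : Set (PartialBij X)} (hv : IsPseudovertex S v) (h : PVLE SS v w) :
    PVImage w = PVImage v := by
  obtain ⟨w', h1, h2⟩ := h
  rw [← pvEquiv_img SS h2, (chain_pv hcomp hinv SS hv h1).2]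

theorem rank_lt (hcomp : ∀ f ∈ S, ∀ g ∈ S, PartialBij.comp g f ∈ S)
    (hinv : ∀ f ∈ S, PartialBij.inv f ∈ S) (SS : SStructure S)
    {v v' : Set (PartialBij X)} (hv : IsPseudovertex S v) (h : Expansion SS v v') :
    v.ncard < v'.ncard := by
  obtain ⟨f, hf, Dh, h, Pt, hh, hP, ⟨P, hPm, Q, hQm, hPQ⟩, rfl⟩ := h
  have hsf := hv.2.2.1 f hf
  have hN := pieces_facts hcomp hinv SS hsf hh hP
  obtain ⟨hD, hDne⟩ := str_dom SS hsf hh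
  obtain ⟨_, ⟨_, hU, _⟩, _⟩ := SS.pat_partition _ hD hDne _ hP
  have hsub : ∀ E ∈ Pt, E ⊆ Dh := fun E hE => hU ▸ Set.subset_sUnion_of_mem hE
  have hdj : Disjoint (v \ {f}) (Pieces f h Pt) := by
    rw [Set.disjoint_left]
    intro g hg hg'
    obtain ⟨y, hy⟩ := img_ne (hv.2.2.1 g hg.1)
    exact disj_notMem (hv.2.2.2 g hg.1 f hf hg.2) hy (hN.img ▸ sub_img hg' hy)
  have h2 : 1 < (Pieces f h Pt).ncard := by
    rw [Set.one_lt_ncard_iff hN.fin]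
    refine ⟨_, _, ⟨P, hPm, rfl⟩, ⟨Q, hQm, rfl⟩, ?_⟩
    intro heq
    apply hPQ
    rw [← dom_piece SS hh (hsub P hPm), ← dom_piece SS hh (hsub Q hQm), heq]
  have h3 : ((v \ {f}) ∪ Pieces f h Pt).ncard = (v \ {f}).ncard + (Pieces f h Pt).ncard :=
    Set.ncard_union_eq hdj (hv.1.subset Set.diff_subset) hN.fin
  have h4 := Set.ncard_diff_singleton_add_one hf hv.1
  change v.ncard < ((v \ {f}) ∪ Pieces f h Pt).ncard
  omega

/-- Admissible replacement sets for `f`. -/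
def Repl (SS : SStructure S) (f : PartialBij X) (N : Set (PartialBij X)) : Prop :=
  N = {f} ∨ ∃ (Dh : Set X) (h : PartialBij X) (Pt : Set (Set X)),
    h ∈ SS.str Dh f.domSet ∧ Pt ∈ SS.pat Dh ∧
    (∃ P ∈ Pt, ∃ Q ∈ Pt, P ≠ Q) ∧ N = Pieces f h Pt

theorem repl_img (hcomp : ∀ f ∈ S, ∀ g ∈ S, PartialBij.comp g f ∈ S)
    (hinv : ∀ f ∈ S, PartialBij.inv f ∈ S) (SS : SStructure S) {f : PartialBij X}
    {N : Set (PartialBij X)} (hf : IsSPair S f) (h : Repl SS f N) :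
    PVImage N = f.imgSet := by
  obtain rfl | ⟨Dh, h, Pt, hh, hP, _, rfl⟩ := h
  · simp [PVImage]
  · exact (pieces_facts hcomp hinv SS hf hh hP).img

theorem multi (hcomp : ∀ f ∈ S, ∀ g ∈ S, PartialBij.comp g f ∈ S)
    (hinv : ∀ f ∈ S, PartialBij.inv f ∈ S) (SS : SStructure S)
    {v : Set (PartialBij X)} (hv : IsPseudovertex S v)
    (N : PartialBij X → Set (PartialBij X)) (hN : ∀ f ∈ v, Repl SS f (N f)) :
    Relation.ReflTransGen (Expansion SS) v (⋃ f ∈ v, N f) := by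
  have key : ∀ T : Set (PartialBij X), T.Finite → T ⊆ v →
      Relation.ReflTransGen (Expansion SS) v ((v \ T) ∪ ⋃ f ∈ T, N f) := by
    intro T hT
    induction T, hT using Set.Finite.induction_on with
    | empty => intro _; simpa using Relation.ReflTransGen.refl
    | @insert f T hfT _ ih =>
      intro hsub
      have hfv : f ∈ v := hsub (Set.mem_insert _ _)
      have hTv : T ⊆ v := fun g hg => hsub (Set.mem_insert_of_mem _ hg)
      have ih := ih hTv
      have hnot : f ∉ ⋃ g ∈ T, N g := by
        intro hmem
        simp only [Set.mem_iUnion] at hmem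
        obtain ⟨g, hg, hfg⟩ := hmem
        obtain ⟨y, hy⟩ := img_ne (hv.2.2.1 f hfv)
        have hgf : g ≠ f := by rintro rfl; exact hfT hg
        refine disj_notMem (hv.2.2.2 g (hTv hg) f hfv hgf) ?_ hy
        rw [← repl_img hcomp hinv SS (hv.2.2.1 g (hTv hg)) (hN g (hTv hg))]
        exact sub_img hfg hy
      have hmem : f ∈ (v \ T) ∪ ⋃ g ∈ T, N g := Or.inl ⟨hfv, hfT⟩
      have heq : (v \ insert f T) ∪ (⋃ g ∈ insert f T, N g)
          = (((v \ T) ∪ ⋃ g ∈ T, N g) \ {f}) ∪ N f := by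
        rw [Set.biUnion_insert, Set.union_diff_distrib, Set.diff_singleton_eq_self hnot,
          Set.diff_diff, Set.union_singleton, Set.union_assoc, Set.union_comm (N f)]
      rw [heq]
      obtain h1 | ⟨Dh, h, Pt, hh, hP, hnt, h1⟩ := hN f hfv
      · rw [h1, Set.diff_union_of_subset (Set.singleton_subset_iff.2 hmem)]
        exact ih
      · exact ih.tail ⟨f, hmem, Dh, h, Pt, hh, hP, hnt, by rw [h1]; rfl⟩
  have := key v hv.1 subset_rfl
  simpa using this

theorem nontriv_or {D : Set X} {Pt : Set (Set X)} (hne : D.Nonempty) (h : IsPartitionOf Pt D) :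
    (∃ P ∈ Pt, ∃ Q ∈ Pt, P ≠ Q) ∨ Pt = {D} := by
  by_cases hc : ∃ P ∈ Pt, ∃ Q ∈ Pt, P ≠ Q
  · exact Or.inl hc
  · right
    push Not at hc
    obtain ⟨x, hx⟩ := hne
    obtain ⟨_, hU, _⟩ := h
    have hx' := hx
    rw [← hU] at hx'
    obtain ⟨E, hE, _⟩ := hx'
    have hs : Pt = {E} := by
      ext F
      exact ⟨fun hF => hc F hF E hE, fun hF => hF ▸ hE⟩
    rw [hs] at hU ⊢
    simp at hU
    rw [hU]

theorem stage_one (hcomp : ∀ f ∈ S, ∀ g ∈ S, PartialBij.comp g f ∈ S)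
    (hinv : ∀ f ∈ S, PartialBij.inv f ∈ S) (SS : SStructure S)
    {v : Set (PartialBij X)} (hv : IsPseudovertex S v) :
    ∃ a, Relation.ReflTransGen (Expansion SS) v a ∧
      ∀ g ∈ a, g ∈ SS.str g.domSet g.imgSet := by
  have hex : ∀ f : PartialBij X, ∃ Pt : Set (Set X), f ∈ v → Pt ∈ SS.pat f.domSet ∧
      ∀ E ∈ Pt, f.restrict E ∈ S ∧ f.restrict E ∈ SS.str E (f.image E) := by
    intro f
    by_cases hf : f ∈ v
    · obtain ⟨h1, h2, h3⟩ := hv.2.2.1 f hf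
      obtain ⟨Pt, h⟩ := SS.generation f h1 h2 h3
      exact ⟨Pt, fun _ => h⟩
    · exact ⟨∅, fun h => absurd h hf⟩
  choose G hG using hex
  have hid : ∀ f : PartialBij X, PartialBij.comp f (PartialBij.idOn f.domSet) = f := by
    intro f
    apply PartialBij.ext_rel
    intro x y
    constructor
    · rintro ⟨z, ⟨_, rfl⟩, h⟩; exact h
    · intro h; exact ⟨x, ⟨⟨y, h⟩, rfl⟩, h⟩
  refine ⟨_, multi hcomp hinv SS hv
    (fun f => Pieces f (PartialBij.idOn f.domSet) (G f)) ?_, ?_⟩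
  · intro f hf
    obtain ⟨h1, h2, _⟩ := hv.2.2.1 f hf
    have hGf := (hG f hf).1
    obtain hnt | ht := nontriv_or h2 (SS.pat_partition _ h1 h2 _ hGf).2.1
    · exact Or.inr ⟨_, _, _, SS.str_id _ h1 h2, hGf, hnt, rfl⟩
    · left
      have hr : f.restrict f.domSet = f := by
        apply PartialBij.ext_rel
        intro x y
        exact ⟨fun h => h.2, fun h => ⟨⟨y, h⟩, h⟩⟩
      ext g
      simp [Pieces, ht, hid, hr]
  · intro g hg
    simp only [Set.mem_iUnion] at hg
    obtain ⟨f, hf, E, hE, rfl⟩ := hg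
    rw [hid]
    have h := ((hG f hf).2 E hE).2
    obtain ⟨_, h2, h3⟩ := SS.str_mem _ _ _ h
    rw [h2, h3]
    exact h

theorem stage_two (hcomp : ∀ f ∈ S, ∀ g ∈ S, PartialBij.comp g f ∈ S)
    (hinv : ∀ f ∈ S, PartialBij.inv f ∈ S) (SS : SStructure S)
    {a : Set (PartialBij X)} (ha : IsPseudovertex S a)
    (hs : ∀ g ∈ a, g ∈ SS.str g.domSet g.imgSet) (R : Set (Set X))
    (hR : ∀ g ∈ a, {F | F ∈ R ∧ F ⊆ g.imgSet} ∈ SS.pat g.imgSet)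
    (hR' : ∀ F ∈ R, ∃ g ∈ a, F ⊆ g.imgSet) :
    PVLE SS a (PartialBij.idOn '' R) := by
  classical
  have hdm : ∀ g ∈ a, IsDomain S g.imgSet := by
    intro g hg
    exact ⟨_, hinv _ (SS.str_mem _ _ _ (hs g hg)).1, rfl⟩
  set N : PartialBij X → Set (PartialBij X) := fun g =>
    if {F | F ∈ R ∧ F ⊆ g.imgSet} = {g.imgSet} then {g} else
      PartialBij.idOn '' {F | F ∈ R ∧ F ⊆ g.imgSet} with hNdef
  have hidstr : ∀ F, IsDomain S F → F.Nonempty →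
      PairRel SS (PartialBij.idOn F) (PartialBij.idOn F) := by
    intro F h1 h2
    refine ⟨PartialBij.idOn F, ?_, ?_⟩
    · rw [domSet_idOn]; exact SS.str_id F h1 h2
    · apply PartialBij.ext_rel
      intro x y
      constructor
      · rintro ⟨hx, rfl⟩; exact ⟨x, ⟨hx, rfl⟩, hx, rfl⟩
      · rintro ⟨z, ⟨hx, rfl⟩, _, rfl⟩; exact ⟨hx, rfl⟩
  have hgid : ∀ g ∈ a, PairRel SS g (PartialBij.idOn g.imgSet) := by
    intro g hg
    refine ⟨g, ?_, ?_⟩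
    · rw [domSet_idOn]; exact hs g hg
    · apply PartialBij.ext_rel
      intro x y
      constructor
      · intro h; exact ⟨y, h, ⟨x, h⟩, rfl⟩
      · rintro ⟨z, h, _, rfl⟩; exact h
  have hFdom : ∀ g ∈ a, ∀ F ∈ R, F ⊆ g.imgSet → IsDomain S F ∧ F.Nonempty := by
    intro g hg F hF hFg
    obtain ⟨_, ⟨he, _, _⟩, hd⟩ :=
      SS.pat_partition _ (hdm g hg) (img_ne (ha.2.2.1 g hg)) _ (hR g hg)
    refine ⟨hd F ⟨hF, hFg⟩, ?_⟩
    by_contra hne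
    rw [Set.not_nonempty_iff_eq_empty] at hne
    exact he (hne ▸ ⟨hF, hFg⟩)
  refine ⟨_, multi hcomp hinv SS ha N ?_, ?_, ?_⟩
  · intro g hg
    have hne := img_ne (ha.2.2.1 g hg)
    by_cases ht : {F | F ∈ R ∧ F ⊆ g.imgSet} = {g.imgSet}
    · left; simp only [hNdef, if_pos ht]
    · right
      obtain hnt | ht' := nontriv_or hne (SS.pat_partition _ (hdm g hg) hne _ (hR g hg)).2.1
      · refine ⟨g.imgSet, PartialBij.inv g, _, SS.str_inv _ _ _ (hs g hg), hR g hg, hnt, ?_⟩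
        simp only [hNdef, if_neg ht]
        have hres : ∀ F, F ⊆ g.imgSet →
            PartialBij.idOn F = (PartialBij.comp g (PartialBij.inv g)).restrict F := by
          intro F hF
          apply PartialBij.ext_rel
          intro x y
          constructor
          · rintro ⟨hx, rfl⟩
            obtain ⟨z, hz⟩ := hF hx
            exact ⟨hx, z, hz, hz⟩
          · rintro ⟨hx, z, h1, h2⟩
            exact ⟨hx, g.functional h1 h2⟩
        ext k
        constructor
        · rintro ⟨F, hF, rfl⟩; exact ⟨F, hF, hres F hF.2⟩
        · rintro ⟨F, hF, rfl⟩; exact ⟨F, hF, hres F hF.2⟩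
      · exact absurd ht' ht
  · intro k hk
    simp only [Set.mem_iUnion] at hk
    obtain ⟨g, hg, hk⟩ := hk
    by_cases ht : {F | F ∈ R ∧ F ⊆ g.imgSet} = {g.imgSet}
    · simp only [hNdef, if_pos ht] at hk
      obtain rfl : k = g := hk
      have : k.imgSet ∈ {F | F ∈ R ∧ F ⊆ k.imgSet} := by rw [ht]; rfl
      exact ⟨_, ⟨_, this.1, rfl⟩, hgid k hg⟩
    · simp only [hNdef, if_neg ht] at hk
      obtain ⟨F, ⟨hF, hFg⟩, rfl⟩ := hk
      obtain ⟨h1, h2⟩ := hFdom g hg F hF hFg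
      exact ⟨_, ⟨F, hF, rfl⟩, hidstr F h1 h2⟩
  · rintro _ ⟨F, hF, rfl⟩
    obtain ⟨g, hg, hFg⟩ := hR' F hF
    simp only [Set.mem_iUnion]
    by_cases ht : {F | F ∈ R ∧ F ⊆ g.imgSet} = {g.imgSet}
    · have hFe : F ∈ {F | F ∈ R ∧ F ⊆ g.imgSet} := ⟨hF, hFg⟩
      rw [ht] at hFe
      obtain rfl : F = g.imgSet := hFe
      refine ⟨g, ⟨g, hg, ?_⟩, hgid g hg⟩
      simp only [hNdef, if_pos ht]; rfl
    · obtain ⟨h1, h2⟩ := hFdom g hg F hF hFg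
      refine ⟨_, ⟨g, hg, ?_⟩, hidstr F h1 h2⟩
      simp only [hNdef, if_neg ht]
      exact ⟨F, ⟨hF, hFg⟩, rfl⟩

theorem part_eq {Q : Set (Set X)} {Y : Set X} (h : IsPartitionOf Q Y) {A B : Set X} {x : X}
    (hA : A ∈ Q) (hB : B ∈ Q) (h1 : x ∈ A) (h2 : x ∈ B) : A = B := by
  by_contra hne
  exact disj_notMem (h.2.2 A hA B hB hne) h1 h2

theorem part_ne {Q : Set (Set X)} {Y : Set X} (h : IsPartitionOf Q Y) {A : Set X}
    (hA : A ∈ Q) : A.Nonempty := by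
  by_contra hne
  rw [Set.not_nonempty_iff_eq_empty] at hne
  exact h.1 (hne ▸ hA)

theorem common_ref (hcomp : ∀ f ∈ S, ∀ g ∈ S, PartialBij.comp g f ∈ S)
    (hinv : ∀ f ∈ S, PartialBij.inv f ∈ S) (SS : SStructure S)
    {Y : Set X} {Q₁ Q₂ : Set (Set X)} (h1 : IsPartitionOf Q₁ Y) (h2 : IsPartitionOf Q₂ Y)
    (f1 : Q₁.Finite) (f2 : Q₂.Finite) (d1 : ∀ A ∈ Q₁, IsDomain S A)
    (d2 : ∀ A ∈ Q₂, IsDomain S A) :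
    ∃ R : Set (Set X), R.Finite ∧ IsPartitionOf R Y ∧ (∀ F ∈ R, IsDomain S F) ∧
      (∀ A ∈ Q₁, {F | F ∈ R ∧ F ⊆ A} ∈ SS.pat A) ∧ (∀ F ∈ R, ∃ A ∈ Q₁, F ⊆ A) ∧
      (∀ A ∈ Q₂, {F | F ∈ R ∧ F ⊆ A} ∈ SS.pat A) ∧ (∀ F ∈ R, ∃ A ∈ Q₂, F ⊆ A) := by
  have ex1 : ∀ A : Set X, ∃ Pt : Set (Set X), A ∈ Q₁ → Pt ∈ SS.pat A ∧
      ∀ C ∈ Pt, ∃ B ∈ Q₂, C ⊆ B := by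
    intro A
    by_cases hA : A ∈ Q₁
    · have hcof := SS.pat_cofinal A (d1 A hA) (part_ne h1 hA)
        {C | ∃ B ∈ Q₂, (A ∩ B).Nonempty ∧ C = A ∩ B} ?_ ⟨?_, ?_, ?_⟩ ?_
      · obtain ⟨Pt, hPt, hr⟩ := hcof
        refine ⟨Pt, fun _ => ⟨hPt, fun C hC => ?_⟩⟩
        obtain ⟨_, ⟨B, hB, _, rfl⟩, hCB⟩ := hr C hC
        exact ⟨B, hB, hCB.trans Set.inter_subset_right⟩
      · refine (f2.image (fun B => A ∩ B)).subset ?_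
        rintro _ ⟨B, hB, _, rfl⟩
        exact ⟨B, hB, rfl⟩
      · rintro ⟨B, hB, hne, he⟩
        rw [← he] at hne
        exact Set.not_nonempty_empty hne
      · ext x
        constructor
        · rintro ⟨_, ⟨B, _, _, rfl⟩, hx⟩; exact hx.1
        · intro hx
          have hxY : x ∈ ⋃₀ Q₂ := by
            rw [h2.2.1, ← h1.2.1]; exact ⟨A, hA, hx⟩
          obtain ⟨B, hB, hxB⟩ := hxY
          exact ⟨_, ⟨B, hB, ⟨x, hx, hxB⟩, rfl⟩, hx, hxB⟩
      · rintro _ ⟨B, hB, _, rfl⟩ _ ⟨B', hB', _, rfl⟩ hne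
        rw [Set.eq_empty_iff_forall_notMem]
        rintro x ⟨hx, hx'⟩
        exact hne (by rw [part_eq h2 hB hB' hx.2 hx'.2])
      · rintro _ ⟨B, hB, _, rfl⟩
        exact domain_inter hcomp hinv (d1 A hA) (d2 B hB)
    · exact ⟨∅, fun h => absurd h hA⟩
  choose P hP using ex1
  have fP : ∀ A ∈ Q₁, (P A).Finite ∧ IsPartitionOf (P A) A ∧ ∀ C ∈ P A, IsDomain S C :=
    fun A hA => SS.pat_partition A (d1 A hA) (part_ne h1 hA) _ (hP A hA).1
  have sP : ∀ A ∈ Q₁, ∀ C ∈ P A, C ⊆ A := fun A hA C hC => by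
    have := Set.subset_sUnion_of_mem hC
    rwa [(fP A hA).2.1.2.1] at this
  have fC : {C | ∃ A ∈ Q₁, C ∈ P A}.Finite := by
    have : {C | ∃ A ∈ Q₁, C ∈ P A} = ⋃ A ∈ Q₁, P A := by ext C; simp
    rw [this]
    exact f1.biUnion (fun A hA => (fP A hA).1)
  have uC : ∀ A ∈ Q₁, ∀ C ∈ P A, ∀ A' ∈ Q₁, ∀ C' ∈ P A', ∀ x ∈ C, x ∈ C' →
      A = A' ∧ C = C' := by
    intro A hA C hC A' hA' C' hC' x hx hx'
    obtain rfl := part_eq h1 hA hA' (sP A hA C hC hx) (sP A' hA' C' hC' hx')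
    exact ⟨rfl, part_eq (fP A hA).2.1 hC hC' hx hx'⟩
  have ex2 : ∀ B : Set X, ∃ Pt : Set (Set X), B ∈ Q₂ → Pt ∈ SS.pat B ∧
      ∀ F ∈ Pt, ∃ A ∈ Q₁, ∃ C ∈ P A, F ⊆ C := by
    intro B
    by_cases hB : B ∈ Q₂
    · have hcof := SS.pat_cofinal B (d2 B hB) (part_ne h2 hB)
        {C | (∃ A ∈ Q₁, C ∈ P A) ∧ C ⊆ B} ?_ ⟨?_, ?_, ?_⟩ ?_
      · obtain ⟨Pt, hPt, hr⟩ := hcof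
        refine ⟨Pt, fun _ => ⟨hPt, fun F hF => ?_⟩⟩
        obtain ⟨C, ⟨⟨A, hA, hC⟩, _⟩, hFC⟩ := hr F hF
        exact ⟨A, hA, C, hC, hFC⟩
      · exact fC.subset (fun C hC => hC.1)
      · rintro ⟨⟨A, hA, hC⟩, _⟩
        exact (fP A hA).2.1.1 hC
      · ext x
        constructor
        · rintro ⟨C, ⟨_, hCB⟩, hx⟩; exact hCB hx
        · intro hx
          have hxY : x ∈ ⋃₀ Q₁ := by
            rw [h1.2.1, ← h2.2.1]; exact ⟨B, hB, hx⟩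
          obtain ⟨A, hA, hxA⟩ := hxY
          rw [← (fP A hA).2.1.2.1] at hxA
          obtain ⟨C, hC, hxC⟩ := hxA
          obtain ⟨B', hB', hCB⟩ := (hP A hA).2 C hC
          obtain rfl := part_eq h2 hB hB' hx (hCB hxC)
          exact ⟨C, ⟨⟨A, hA, hC⟩, hCB⟩, hxC⟩
      · rintro C ⟨⟨A, hA, hC⟩, _⟩ C' ⟨⟨A', hA', hC'⟩, _⟩ hne
        rw [Set.eq_empty_iff_forall_notMem]
        rintro x ⟨hx, hx'⟩
        exact hne (uC A hA C hC A' hA' C' hC' x hx hx').2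
      · rintro C ⟨⟨A, hA, hC⟩, _⟩
        exact (fP A hA).2.2 C hC
    · exact ⟨∅, fun h => absurd h hB⟩
  choose P' hP' using ex2
  have fP' : ∀ B ∈ Q₂, (P' B).Finite ∧ IsPartitionOf (P' B) B ∧ ∀ C ∈ P' B, IsDomain S C :=
    fun A hA => SS.pat_partition A (d2 A hA) (part_ne h2 hA) _ (hP' A hA).1
  have sP' : ∀ B ∈ Q₂, ∀ F ∈ P' B, F ⊆ B := fun A hA C hC => by
    have := Set.subset_sUnion_of_mem hC
    rwa [(fP' A hA).2.1.2.1] at this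
  refine ⟨{F | ∃ B ∈ Q₂, F ∈ P' B}, ?_, ⟨?_, ?_, ?_⟩, ?_, ?_, ?_, ?_, ?_⟩
  · have : {C | ∃ A ∈ Q₂, C ∈ P' A} = ⋃ A ∈ Q₂, P' A := by ext C; simp
    rw [this]
    exact f2.biUnion (fun A hA => (fP' A hA).1)
  · rintro ⟨B, hB, hF⟩; exact (fP' B hB).2.1.1 hF
  · rw [← h2.2.1]
    ext x
    constructor
    · rintro ⟨F, ⟨B, hB, hF⟩, hx⟩
      exact ⟨B, hB, sP' B hB F hF hx⟩
    · rintro ⟨B, hB, hx⟩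
      rw [← (fP' B hB).2.1.2.1] at hx
      obtain ⟨F, hF, hx⟩ := hx
      exact ⟨F, ⟨B, hB, hF⟩, hx⟩
  · rintro F ⟨B, hB, hF⟩ F' ⟨B', hB', hF'⟩ hne
    rw [Set.eq_empty_iff_forall_notMem]
    rintro x ⟨hx, hx'⟩
    obtain rfl := part_eq h2 hB hB' (sP' B hB F hF hx) (sP' B' hB' F' hF' hx')
    exact hne (part_eq (fP' B hB).2.1 hF hF' hx hx')
  · rintro F ⟨B, hB, hF⟩; exact (fP' B hB).2.2 F hF
  · intro A hA
    have hpw := SS.pat_patchwork A (d1 A hA) (part_ne h1 hA) (P A) (hP A hA).1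
      (fun C => {F | (∃ B ∈ Q₂, F ∈ P' B) ∧ F ⊆ C}) ?_
    · convert hpw using 1
      ext F
      constructor
      · rintro ⟨⟨B, hB, hF⟩, hFA⟩
        obtain ⟨A', hA', C, hC, hFC⟩ := (hP' B hB).2 F hF
        obtain ⟨x, hx⟩ := part_ne (fP' B hB).2.1 hF
        obtain rfl := part_eq h1 hA hA' (hFA hx) (sP A' hA' C hC (hFC hx))
        exact ⟨C, hC, ⟨B, hB, hF⟩, hFC⟩
      · rintro ⟨C, hC, hF, hFC⟩
        exact ⟨hF, hFC.trans (sP A hA C hC)⟩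
    · intro C hC
      obtain ⟨B, hB, hCB⟩ := (hP A hA).2 C hC
      have hCne := part_ne (fP A hA).2.1 hC
      have := SS.pat_restrict B C (d2 B hB) (part_ne h2 hB) ((fP A hA).2.2 C hC)
        hCne hCB (P' B) (hP' B hB).1
      convert this using 1
      ext F
      constructor
      · rintro ⟨⟨B', hB', hF⟩, hFC⟩
        obtain ⟨x, hx⟩ := part_ne (fP' B' hB').2.1 hF
        obtain rfl := part_eq h2 hB hB' (hCB (hFC hx)) (sP' B' hB' F hF hx)
        exact ⟨F, hF, ⟨x, hx, hFC hx⟩, (Set.inter_eq_left.2 hFC).symm⟩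
      · rintro ⟨F', hF', ⟨x, hx, hxC⟩, rfl⟩
        obtain ⟨A', hA', C', hC', hFC⟩ := (hP' B hB).2 F' hF'
        obtain ⟨_, rfl⟩ := uC A hA C hC A' hA' C' hC' x hxC (hFC hx)
        rw [Set.inter_eq_left.2 hFC]
        exact ⟨⟨B, hB, hF'⟩, hFC⟩
  · rintro F ⟨B, hB, hF⟩
    obtain ⟨A, hA, C, hC, hFC⟩ := (hP' B hB).2 F hF
    exact ⟨A, hA, hFC.trans (sP A hA C hC)⟩
  · intro B hB
    have : {F | F ∈ {F | ∃ B ∈ Q₂, F ∈ P' B} ∧ F ⊆ B} = P' B := by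
      ext F
      constructor
      · rintro ⟨⟨B', hB', hF⟩, hFB⟩
        obtain ⟨x, hx⟩ := part_ne (fP' B' hB').2.1 hF
        obtain rfl := part_eq h2 hB hB' (hFB hx) (sP' B' hB' F hF hx)
        exact hF
      · intro hF
        exact ⟨⟨B, hB, hF⟩, sP' B hB F hF⟩
    rw [this]
    exact (hP' B hB).1
  · rintro F ⟨B, hB, hF⟩
    exact ⟨B, hB, sP' B hB F hF⟩

theorem img_partition {a : Set (PartialBij X)} (ha : IsPseudovertex S a) :
    IsPartitionOf (PartialBij.imgSet '' a) (PVImage a) := by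
  refine ⟨?_, ?_, ?_⟩
  · rintro ⟨g, hg, he⟩
    have := img_ne (ha.2.2.1 g hg)
    rw [he] at this
    exact Set.not_nonempty_empty this
  · simp [PVImage]
  · rintro _ ⟨g, hg, rfl⟩ _ ⟨g', hg', rfl⟩ hne
    exact ha.2.2.2 g hg g' hg' (by rintro rfl; exact hne rfl)

theorem upper_bound (hcomp : ∀ f ∈ S, ∀ g ∈ S, PartialBij.comp g f ∈ S)
    (hinv : ∀ f ∈ S, PartialBij.inv f ∈ S) (SS : SStructure S)
    {v v' : Set (PartialBij X)} (hv : IsPseudovertex S v) (hv' : IsPseudovertex S v')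
    (him : PVImage v = PVImage v') :
    ∃ w : Set (PartialBij X), IsPseudovertex S w ∧ PVLE SS v w ∧ PVLE SS v' w := by
  obtain ⟨a, hva, has⟩ := stage_one hcomp hinv SS hv
  obtain ⟨a', hva', has'⟩ := stage_one hcomp hinv SS hv'
  obtain ⟨pa, ia⟩ := chain_pv hcomp hinv SS hv hva
  obtain ⟨pa', ia'⟩ := chain_pv hcomp hinv SS hv' hva'
  have hdm : ∀ g, g ∈ SS.str g.domSet g.imgSet → IsDomain S g.imgSet := fun g hg =>
    ⟨_, hinv _ (SS.str_mem _ _ _ hg).1, rfl⟩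
  have q1 := img_partition pa
  have q2 := img_partition pa'
  rw [ia] at q1
  rw [ia', ← him] at q2
  obtain ⟨R, hfin, hpart, hdom, r1, r2, r3, r4⟩ := common_ref hcomp hinv SS q1 q2
    (pa.1.image _) (pa'.1.image _)
    (by rintro _ ⟨g, hg, rfl⟩; exact hdm g (has g hg))
    (by rintro _ ⟨g, hg, rfl⟩; exact hdm g (has' g hg))
  have t1 := stage_two hcomp hinv SS pa has R (fun g hg => r1 _ ⟨g, hg, rfl⟩)
    (fun F hF => by obtain ⟨_, ⟨g, hg, rfl⟩, h⟩ := r2 F hF; exact ⟨g, hg, h⟩)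
  have t2 := stage_two hcomp hinv SS pa' has' R (fun g hg => r3 _ ⟨g, hg, rfl⟩)
    (fun F hF => by obtain ⟨_, ⟨g, hg, rfl⟩, h⟩ := r4 F hF; exact ⟨g, hg, h⟩)
  refine ⟨PartialBij.idOn '' R, ⟨hfin.image _, ?_, ?_, ?_⟩, ?_, ?_⟩
  · obtain ⟨f, hf⟩ := hv.2.1
    obtain ⟨y, hy⟩ := img_ne (hv.2.2.1 f hf)
    have hyY := sub_img hf hy
    rw [← hpart.2.1] at hyY
    obtain ⟨F, hF, _⟩ := hyY
    exact ⟨_, F, hF, rfl⟩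
  · rintro _ ⟨F, hF, rfl⟩
    exact spair_idOn hcomp hinv (hdom F hF) (part_ne hpart hF)
  · rintro _ ⟨F, hF, rfl⟩ _ ⟨F', hF', rfl⟩ hne
    rw [imgSet_idOn, imgSet_idOn]
    exact hpart.2.2 F hF F' hF' (by rintro rfl; exact hne rfl)
  · obtain ⟨w', h1, h2⟩ := t1
    exact ⟨w', hva.trans h1, h2⟩
  · obtain ⟨w', h1, h2⟩ := t2
    exact ⟨w', hva'.trans h1, h2⟩

end aux

/-- two pseudovertices have a common upper bound iff they have the
same image; consequently, for each `Y` that is a nonempty finite disjoint union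
of domains, the pseudovertices with image `Y` form a directed set, and the rank
`|v|` is strictly increasing along expansions. -/
theorem statement14 {X : Type*} (S : Set (PartialBij X))
    (hcomp : ∀ f ∈ S, ∀ g ∈ S, PartialBij.comp g f ∈ S)
    (hinv : ∀ f ∈ S, PartialBij.inv f ∈ S)
    (SS : SStructure S) :
    (∀ v v' : Set (PartialBij X), IsPseudovertex S v → IsPseudovertex S v' →
      ((∃ w : Set (PartialBij X), IsPseudovertex S w ∧ PVLE SS v w ∧ PVLE SS v' w)
        ↔ PVImage v = PVImage v')) ∧
    (∀ Y : Set X, Y.Nonempty → FinDisjUnionOfDomains S Y →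
      ∀ v v' : Set (PartialBij X), IsPseudovertex S v → IsPseudovertex S v' →
        PVImage v = Y → PVImage v' = Y →
        ∃ w : Set (PartialBij X), IsPseudovertex S w ∧ PVImage w = Y ∧
          PVLE SS v w ∧ PVLE SS v' w) ∧
    (∀ v v' : Set (PartialBij X), IsPseudovertex S v → Expansion SS v v' →
      v.ncard < v'.ncard) := by
  refine ⟨?_, ?_, ?_⟩
  · intro v v' hv hv'
    constructor
    · rintro ⟨w, _, h1, h2⟩
      rw [← pvle_img hcomp hinv SS hv h1, ← pvle_img hcomp hinv SS hv' h2]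
    · exact upper_bound hcomp hinv SS hv hv'
  · intro Y _ _ v v' hv hv' h1 h2
    obtain ⟨w, hw, ha, hb⟩ := upper_bound hcomp hinv SS hv hv' (h1.trans h2.symm)
    exact ⟨w, hw, (pvle_img hcomp hinv SS hv ha).trans h1, ha, hb⟩
  · intro v v' hv h
    exact rank_lt hcomp hinv SS hv h

end GTLD
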